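/- Let (ℰ,𝓕) be a regular resistance form on a nonempty set F whose resistance metric R makes (F,R) a compact metric space, and let V₁,…,V_J be nonempty pairwise disjoint compact subsets of F. Then the fused form (ℰ̃,𝓕̃) is a regular resistance form on the quotient set F̃ (that is, it satisfies axioms RF1–RF5 and the regularity condition). Moreover its resistance metric R̃ satisfies R̃(π(x),π(y)) ≤ R(x,y) for all x,y ∈ F, and (F̃,R̃) is a compact metric space. -/

import Mathlib

open Filter Topology MeasureTheory
open scoped ENNReal

/-- A resistance form `(ℰ,𝓕)` on a nonempty set `F`:
`dom` is a linear subspace of `F → ℝ` containing the constants, and `energy`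
is a nonnegative symmetric bilinear form satisfying RF1–RF5. -/
structure ResistanceForm (F : Type*) where
  dom : Set (F → ℝ)
  energy : (F → ℝ) → (F → ℝ) → ℝ
  const_mem : ∀ c : ℝ, (fun _ => c) ∈ dom
  add_mem : ∀ f ∈ dom, ∀ g ∈ dom, f + g ∈ dom
  smul_mem : ∀ (c : ℝ), ∀ f ∈ dom, c • f ∈ dom
  symm : ∀ f g, energy f g = energy g f
  add_left : ∀ f g h, energy (f + g) h = energy f h + energy g h
  smul_left : ∀ (c : ℝ) (f g), energy (c • f) g = c * energy f g
  nonneg : ∀ f ∈ dom, 0 ≤ energy f f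
  -- RF1: `ℰ(f,f) = 0` iff `f` is constant
  rf1 : ∀ f ∈ dom, (energy f f = 0 ↔ ∃ c : ℝ, ∀ x, f x = c)
  -- RF2: the quotient of `dom` by the constants is complete (hence a Hilbert space)
  rf2 : ∀ f : ℕ → F → ℝ, (∀ n, f n ∈ dom) →
    (∀ ε > (0:ℝ), ∃ N, ∀ m ≥ N, ∀ n ≥ N, energy (f m - f n) (f m - f n) < ε) →
    ∃ g ∈ dom, Tendsto (fun n => energy (f n - g) (f n - g)) atTop (𝓝 0)
  -- RF3: `dom` separates points
  rf3 : ∀ x y : F, x ≠ y → ∃ f ∈ dom, f x ≠ f y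
  -- RF4: the resistance between two points is finite
  rf4 : ∀ x y : F,
    BddAbove {r : ℝ | ∃ f ∈ dom, 0 < energy f f ∧ r = |f x - f y| ^ 2 / energy f f}
  -- RF5: the Markov property
  rf5 : ∀ f ∈ dom, (fun x => max (min (f x) 1) 0) ∈ dom ∧
    energy (fun x => max (min (f x) 1) 0) (fun x => max (min (f x) 1) 0) ≤ energy f f

namespace ResistanceForm

variable {F : Type*} (Φ : ResistanceForm F)

/-- The resistance metric `R(x,y)`. -/
noncomputable def Rmet (x y : F) : ℝ :=
  sSup {r : ℝ | ∃ f ∈ Φ.dom, 0 < Φ.energy f f ∧ r = |f x - f y| ^ 2 / Φ.energy f f}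

/-- The effective resistance `R(x,A)` between a point and a set, valued in `[0,∞]`,
with `sInf ∅ = ∞`, `∞⁻¹ = 0` and `0⁻¹ = ∞`. -/
noncomputable def resToSet (x : F) (A : Set F) : ℝ≥0∞ :=
  (sInf {e : ℝ≥0∞ | ∃ f ∈ Φ.dom, f x = 1 ∧ (∀ y ∈ A, f y = 0) ∧
    e = ENNReal.ofReal (Φ.energy f f)})⁻¹

/-- The open ball of radius `r` about `x` in the resistance metric. -/
def ball (x : F) (r : ℝ) : Set F := {y | Φ.Rmet x y < r}

end ResistanceForm

namespace ResistanceForm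

variable {F : Type*} (Φ : ResistanceForm F)

/-- `R_A(y,z)`: the resistance between `y` and `z` in the network with `A` fused,
`sup{ ℰ(f,f)⁻¹ : f ∈ 𝓕, f(y) = 1, f(z) = 0, f constant on A }` (with `sSup ∅ = 0`). -/
noncomputable def fusedRes (A : Set F) (y z : F) : ℝ :=
  sSup {r : ℝ | ∃ f ∈ Φ.dom, f y = 1 ∧ f z = 0 ∧
    (∀ a ∈ A, ∀ b ∈ A, f a = f b) ∧ r = (Φ.energy f f)⁻¹}

/-- The resolvent kernel `g_A(y,z) = (R(y,A) + R(z,A) - R_A(y,z))/2`. -/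
noncomputable def resKernel (A : Set F) (y z : F) : ℝ :=
  ((Φ.resToSet y A).toReal + (Φ.resToSet z A).toReal - Φ.fusedRes A y z) / 2

/-- Regularity of a resistance form: `𝓕 ∩ C₀(F)` is dense in `C₀(F)` in the
supremum norm, where the topology on `F` is that of the resistance metric. -/
def Regular [MetricSpace F] : Prop :=
  ∀ g : F → ℝ, Continuous g → HasCompactSupport g → ∀ ε > (0:ℝ),
    ∃ f ∈ Φ.dom, Continuous f ∧ HasCompactSupport f ∧ ∀ x, |f x - g x| ≤ ε

end ResistanceForm

/-- The setoid on `F` identifying each of the sets `V j` to a single point: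
the equivalence relation generated by relating points lying in a common `V j`. -/
def fuseSetoid {F : Type*} {J : ℕ} (V : Fin J → Set F) : Setoid F :=
  Relation.EqvGen.setoid (fun x y => ∃ j, x ∈ V j ∧ y ∈ V j)

namespace ResistanceForm

variable {F : Type*} (Φ : ResistanceForm F)

theorem add_right (f g h : F → ℝ) : Φ.energy f (g + h) = Φ.energy f g + Φ.energy f h := by
  rw [Φ.symm, Φ.add_left, Φ.symm g, Φ.symm h]

theorem smul_right (c : ℝ) (f g : F → ℝ) : Φ.energy f (c • g) = c * Φ.energy f g := by
  rw [Φ.symm, Φ.smul_left, Φ.symm g]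

theorem sub_mem {f g : F → ℝ} (hf : f ∈ Φ.dom) (hg : g ∈ Φ.dom) : f - g ∈ Φ.dom := by
  have h := Φ.add_mem f hf _ (Φ.smul_mem (-1) g hg)
  rwa [neg_one_smul, ← sub_eq_add_neg] at h

theorem energy_const_self (c : ℝ) : Φ.energy (fun _ => c) (fun _ => c) = 0 :=
  (Φ.rf1 _ (Φ.const_mem c)).2 ⟨c, fun _ => rfl⟩

theorem energy_add_smul_self (f g : F → ℝ) (s : ℝ) :
    Φ.energy (f + s • g) (f + s • g) =
      Φ.energy f f + 2 * s * Φ.energy f g + s ^ 2 * Φ.energy g g := by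
  simp only [Φ.add_left, Φ.add_right, Φ.smul_left, Φ.smul_right, Φ.symm g f]
  ring

/-- A constant function is in the radical of the energy form. -/
theorem energy_const_right {f : F → ℝ} (hf : f ∈ Φ.dom) (c : ℝ) :
    Φ.energy f (fun _ => c) = 0 := by
  by_contra hne
  set b := Φ.energy f (fun _ => c)
  have hmem := Φ.add_mem f hf _ (Φ.smul_mem (-(Φ.energy f f + 1) / (2 * b)) _ (Φ.const_mem c))
  have h := Φ.nonneg _ hmem
  rw [energy_add_smul_self, energy_const_self] at h
  have : 2 * (-(Φ.energy f f + 1) / (2 * b)) * b = -(Φ.energy f f + 1) := by field_simp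
  rw [this] at h
  linarith

theorem energy_add_const {f : F → ℝ} (hf : f ∈ Φ.dom) (c : ℝ) :
    Φ.energy (f + fun _ => c) (f + fun _ => c) = Φ.energy f f := by
  have h := Φ.energy_add_smul_self f (fun _ => c) 1
  rw [one_smul, Φ.energy_const_right hf, Φ.energy_const_self] at h
  rw [h]
  ring

/-- The Markov property for truncation to an interval `[0, M]`. -/
theorem clamp_mem {f : F → ℝ} (hf : f ∈ Φ.dom) {M : ℝ} (hM : 0 < M) :
    (fun x => max (min (f x) M) 0) ∈ Φ.dom ∧
      Φ.energy (fun x => max (min (f x) M) 0) (fun x => max (min (f x) M) 0) ≤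
        Φ.energy f f := by
  obtain ⟨h, hle⟩ := Φ.rf5 _ (Φ.smul_mem M⁻¹ f hf)
  have heq : (fun x => max (min (f x) M) 0) =
      M • fun x => max (min ((M⁻¹ • f) x) 1) 0 := by
    ext x
    simp only [Pi.smul_apply, smul_eq_mul]
    rw [mul_max_of_nonneg _ _ hM.le, mul_min_of_nonneg _ _ hM.le, mul_inv_cancel_left₀ hM.ne']
    simp
  rw [heq]
  refine ⟨Φ.smul_mem _ _ h, ?_⟩
  rw [Φ.smul_left, Φ.smul_right]
  rw [Φ.smul_left, Φ.smul_right] at hle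
  calc _ ≤ M * (M * (M⁻¹ * (M⁻¹ * Φ.energy f f))) := by gcongr
    _ = Φ.energy f f := by field_simp

theorem posPart_mem {f : F → ℝ} (hf : f ∈ Φ.dom) {M : ℝ} (hM : ∀ x, f x ≤ M) :
    (fun x => max (f x) 0) ∈ Φ.dom ∧
      Φ.energy (fun x => max (f x) 0) (fun x => max (f x) 0) ≤ Φ.energy f f := by
  have h := Φ.clamp_mem hf (M := max M 1) (by positivity)
  have heq : (fun x => max (min (f x) (max M 1)) 0) = fun x => max (f x) 0 := by
    ext x
    rw [min_eq_left ((hM x).trans (le_max_left _ _))]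
  rwa [heq] at h

theorem max_mem {f g : F → ℝ} (hf : f ∈ Φ.dom) (hg : g ∈ Φ.dom) {M : ℝ}
    (hM : ∀ x, f x - g x ≤ M) : (fun x => max (f x) (g x)) ∈ Φ.dom := by
  have h := Φ.add_mem _ (Φ.posPart_mem (Φ.sub_mem hf hg) hM).1 g hg
  convert h using 1
  ext x
  simp [max_add]

theorem min_mem {f g : F → ℝ} (hf : f ∈ Φ.dom) (hg : g ∈ Φ.dom) {M : ℝ}
    (hM : ∀ x, f x - g x ≤ M) : (fun x => min (f x) (g x)) ∈ Φ.dom := by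
  have h := Φ.sub_mem hf (Φ.posPart_mem (Φ.sub_mem hf hg) hM).1
  convert h using 1
  ext x
  simp only [Pi.sub_apply]
  rcases le_total (f x) (g x) with h | h
  · rw [min_eq_left h, max_eq_right (by linarith)]; ring
  · rw [min_eq_right h, max_eq_left (by linarith)]; ring

/-- Splitting a function bounded above at level `0` does not increase the total energy. -/
theorem energy_posPart_add_energy_min_le {f : F → ℝ} (hf : f ∈ Φ.dom) {M : ℝ}
    (hM : ∀ x, f x ≤ M) :
    Φ.energy (fun x => max (f x) 0) (fun x => max (f x) 0) +
      Φ.energy (fun x => min (f x) 0) (fun x => min (f x) 0) ≤ Φ.energy f f := by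
  set u : F → ℝ := fun x => max (f x) 0
  set v : F → ℝ := fun x => min (f x) 0
  have hu : u ∈ Φ.dom := (Φ.posPart_mem hf hM).1
  have hfuv : f = u + (1 : ℝ) • v := by
    ext x
    simp [u, v, max_add_min]
  have hv : v ∈ Φ.dom := by
    have : v = f - u := by rw [hfuv]; simp
    rw [this]
    exact Φ.sub_mem hf hu
  have hcross : ∀ s : ℝ, 0 < s → 0 ≤ 2 * Φ.energy u v + s * Φ.energy v v := by
    intro s hs
    have hmem := Φ.add_mem u hu _ (Φ.smul_mem s v hv)
    have hpos : (fun x => max ((u + s • v) x) 0) = u := by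
      ext x
      simp only [Pi.add_apply, Pi.smul_apply, smul_eq_mul, u, v]
      rcases le_total (f x) 0 with h | h
      · rw [max_eq_right h, min_eq_left h, zero_add, max_eq_right]
        exact mul_nonpos_of_nonneg_of_nonpos hs.le h
      · rw [max_eq_left h, min_eq_right h, mul_zero, add_zero, max_eq_left h]
    have hbd : ∀ x, (u + s • v) x ≤ max M 0 := by
      intro x
      have h1 : u x ≤ max M 0 := max_le_max (hM x) le_rfl
      have h2 : s * v x ≤ 0 := mul_nonpos_of_nonneg_of_nonpos hs.le (min_le_right _ _)
      simp only [Pi.add_apply, Pi.smul_apply, smul_eq_mul]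
      linarith
    have h := (Φ.posPart_mem hmem hbd).2
    rw [hpos, energy_add_smul_self] at h
    refine nonneg_of_mul_nonneg_right (a := s) ?_ hs
    linarith
  have huv : 0 ≤ Φ.energy u v := by
    by_contra! hneg
    have hv0 := Φ.nonneg v hv
    have h := hcross (-Φ.energy u v / (Φ.energy v v + 1)) (by
      apply div_pos <;> linarith)
    have : -Φ.energy u v / (Φ.energy v v + 1) * Φ.energy v v ≤ -Φ.energy u v := by
      rw [div_mul_eq_mul_div, div_le_iff₀ (by linarith)]
      nlinarith
    linarith
  have h := Φ.energy_add_smul_self u v 1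
  rw [← hfuv] at h
  linarith

theorem Rmet_nonneg (x y : F) : 0 ≤ Φ.Rmet x y := by
  refine Real.sSup_nonneg ?_
  rintro _ ⟨f, -, hpos, rfl⟩
  positivity

theorem Rmet_self (x : F) : Φ.Rmet x x = 0 := by
  refine le_antisymm (Real.sSup_le ?_ le_rfl) (Φ.Rmet_nonneg x x)
  rintro _ ⟨f, -, -, rfl⟩
  simp

theorem Rmet_comm (x y : F) : Φ.Rmet x y = Φ.Rmet y x := by
  simp only [Rmet, abs_sub_comm]

theorem sq_sub_le {f : F → ℝ} (hf : f ∈ Φ.dom) (x y : F) :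
    (f x - f y) ^ 2 ≤ Φ.Rmet x y * Φ.energy f f := by
  rcases (Φ.nonneg f hf).eq_or_lt with h0 | hpos
  · obtain ⟨c, hc⟩ := (Φ.rf1 f hf).1 h0.symm
    simp [← h0, hc]
  · rw [← div_le_iff₀ hpos, ← sq_abs]
    exact le_csSup (Φ.rf4 x y) ⟨f, hf, hpos, rfl⟩

theorem Rmet_le_of_forall {x y : F} {r : ℝ} (hr : 0 ≤ r)
    (h : ∀ f ∈ Φ.dom, (f x - f y) ^ 2 ≤ r * Φ.energy f f) : Φ.Rmet x y ≤ r := by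
  refine Real.sSup_le ?_ hr
  rintro _ ⟨f, hf, hpos, rfl⟩
  rw [div_le_iff₀ hpos, sq_abs]
  exact h f hf

theorem eq_of_Rmet_eq_zero {x y : F} (h : Φ.Rmet x y = 0) : x = y := by
  by_contra hne
  obtain ⟨f, hf, hfne⟩ := Φ.rf3 x y hne
  have hsq := Φ.sq_sub_le hf x y
  rw [h, zero_mul] at hsq
  exact hfne (sub_eq_zero.1 (pow_eq_zero_iff two_ne_zero |>.1 (le_antisymm hsq (sq_nonneg _))))

theorem one_le_mul_energy {f : F → ℝ} (hf : f ∈ Φ.dom) (h0 : ∀ w, 0 ≤ f w)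
    (h1 : ∀ w, f w ≤ 1) {x z : F} (hx : f x = 1) (hz : f z = 0) (y : F) :
    1 ≤ (Φ.Rmet x y + Φ.Rmet y z) * Φ.energy f f := by
  set t := f y
  set g : F → ℝ := f + fun _ => -t
  have hg : g ∈ Φ.dom := Φ.add_mem f hf _ (Φ.const_mem _)
  have hgE : Φ.energy g g = Φ.energy f f := Φ.energy_add_const hf _
  have hgM : ∀ w, g w ≤ 1 - t := fun w => by
    have := h1 w
    simp only [g, Pi.add_apply]
    linarith
  have hsplit := Φ.energy_posPart_add_energy_min_le hg hgM
  have hu := (Φ.posPart_mem hg hgM).1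
  have hv := Φ.min_mem hg (Φ.const_mem 0) (M := 1 - t) (by simpa using hgM)
  have ht0 : 0 ≤ t := h0 y
  have ht1 : t ≤ 1 := h1 y
  have hux := Φ.sq_sub_le hu x y
  have hvz := Φ.sq_sub_le hv y z
  have hgx : g x = 1 - t := by simp [g, hx, sub_eq_add_neg]
  have hgy : g y = 0 := by simp [g, t]
  have hgz : g z = -t := by simp [g, hz]
  simp only [hgx, hgy, hgz] at hux hvz
  rw [max_eq_left (by linarith), max_self, sub_zero] at hux
  rw [min_self, min_eq_left (by linarith), zero_sub, neg_neg] at hvz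
  rw [hgE] at hsplit
  have hR1 := Φ.Rmet_nonneg x y
  have hR2 := Φ.Rmet_nonneg y z
  have hE1 := Φ.nonneg _ hu
  have hE2 := Φ.nonneg _ hv
  generalize Φ.energy (fun x => max (g x) 0) (fun x => max (g x) 0) = E₁ at *
  generalize Φ.energy (fun x => min (g x) 0) (fun x => min (g x) 0) = E₂ at *
  generalize Φ.Rmet x y = R₁ at *
  generalize Φ.Rmet y z = R₂ at *
  have hcross : 2 * ((1 - t) * t) ≤ R₁ * E₂ + R₂ * E₁ := by
    refine abs_le_of_sq_le_sq' ?_ (by positivity) |>.2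
    have hprod := mul_le_mul hux hvz (sq_nonneg t) (by positivity)
    nlinarith [sq_nonneg (R₁ * E₂ - R₂ * E₁)]
  calc 1 ≤ (R₁ + R₂) * (E₁ + E₂) := by nlinarith
    _ ≤ _ := by gcongr

theorem Rmet_triangle (x y z : F) : Φ.Rmet x z ≤ Φ.Rmet x y + Φ.Rmet y z := by
  have hr : 0 ≤ Φ.Rmet x y + Φ.Rmet y z := add_nonneg (Φ.Rmet_nonneg x y) (Φ.Rmet_nonneg y z)
  refine Φ.Rmet_le_of_forall hr fun f hf => ?_
  set d := f x - f z
  by_cases hd : d = 0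
  · rw [hd]
    simpa using mul_nonneg hr (Φ.nonneg f hf)
  set g : F → ℝ := d⁻¹ • (f + fun _ => -f z)
  have hfz := Φ.add_mem f hf _ (Φ.const_mem (-f z))
  have hg : g ∈ Φ.dom := Φ.smul_mem _ _ hfz
  obtain ⟨hc, hcE⟩ := Φ.rf5 g hg
  have hgx : g x = 1 := by
    simp only [g, Pi.smul_apply, Pi.add_apply, smul_eq_mul, ← sub_eq_add_neg]
    exact inv_mul_cancel₀ hd
  have hgz : g z = 0 := by simp [g]
  have h := Φ.one_le_mul_energy hc (fun w => le_max_right _ _)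
    (fun w => max_le (min_le_right _ _) zero_le_one) (x := x) (z := z)
    (by simp [hgx]) (by simp [hgz]) y
  have hgE : Φ.energy g g = Φ.energy f f / d ^ 2 := by
    simp only [g]
    rw [Φ.smul_left, Φ.smul_right, Φ.energy_add_const hf]
    field_simp
  have h2 := h.trans (mul_le_mul_of_nonneg_left hcE hr)
  rwa [hgE, ← mul_div_assoc, one_le_div (by positivity)] at h2

/-- The metric space structure given by the resistance metric. -/
noncomputable abbrev resistanceMetricSpace : MetricSpace F where
  dist := Φ.Rmet
  dist_self := Φ.Rmet_self
  dist_comm := Φ.Rmet_comm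
  dist_triangle := Φ.Rmet_triangle
  eq_of_dist_eq_zero := Φ.eq_of_Rmet_eq_zero

theorem continuous_of_mem_dom [MetricSpace F] (hdist : ∀ x y : F, dist x y = Φ.Rmet x y)
    {f : F → ℝ} (hf : f ∈ Φ.dom) : Continuous f := by
  rw [continuous_iff_continuousAt]
  intro x
  rw [ContinuousAt, tendsto_iff_dist_tendsto_zero]
  have hlim : Tendsto (fun y => √(dist y x * Φ.energy f f)) (𝓝 x) (𝓝 0) := by
    have : Continuous fun y => √(dist y x * Φ.energy f f) := by fun_prop
    simpa using this.tendsto x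
  refine squeeze_zero (fun _ => dist_nonneg) (fun y => ?_) hlim
  rw [Real.dist_eq]
  refine Real.abs_le_sqrt ?_
  rw [hdist]
  exact Φ.sq_sub_le hf y x

/-- A resistance form whose resistance metric is compact is regular. -/
theorem regular_of_compactSpace [MetricSpace F] [CompactSpace F]
    (hdist : ∀ x y : F, dist x y = Φ.Rmet x y) : Φ.Regular := by
  intro g hg _ ε hε
  let L : Set C(F, ℝ) := {f | (f : F → ℝ) ∈ Φ.dom}
  have hbdd : ∀ f g : C(F, ℝ), ∃ M, ∀ x, f x - g x ≤ M := fun f g => by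
    obtain ⟨M, hM⟩ := (isCompact_range (f - g).continuous).bddAbove
    exact ⟨M, fun x => hM ⟨x, rfl⟩⟩
  have hL : closure L = ⊤ := by
    refine ContinuousMap.sublattice_closure_eq_top L
      ⟨ContinuousMap.const F 0, Φ.const_mem 0⟩ ?_ ?_ ?_
    · intro f hf g hg
      exact Φ.min_mem hf hg (hbdd f g).choose_spec
    · intro f hf g hg
      exact Φ.max_mem hf hg (hbdd f g).choose_spec
    · intro v x y
      by_cases hxy : x = y
      · subst hxy
        exact ⟨ContinuousMap.const F (v x), Φ.const_mem _, rfl, rfl⟩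
      obtain ⟨f, hf, hne⟩ := Φ.rf3 x y hxy
      have hmem := Φ.add_mem _ (Φ.smul_mem ((v x - v y) / (f x - f y)) _
        (Φ.add_mem f hf _ (Φ.const_mem (-f y)))) _ (Φ.const_mem (v y))
      refine ⟨⟨_, Φ.continuous_of_mem_dom hdist hmem⟩, hmem, ?_, ?_⟩
      · have : f x - f y ≠ 0 := sub_ne_zero.2 hne
        simp only [ContinuousMap.coe_mk, Pi.smul_apply, Pi.add_apply, smul_eq_mul,
          ← sub_eq_add_neg, div_mul_cancel₀ _ this, sub_add_cancel]
      · simp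
  have hmem : (⟨g, hg⟩ : C(F, ℝ)) ∈ closure L := by rw [hL]; trivial
  obtain ⟨f, hf, hfg⟩ := Metric.mem_closure_iff.1 hmem ε hε
  refine ⟨f, hf, f.continuous, HasCompactSupport.of_compactSpace _, fun x => ?_⟩
  have h := (ContinuousMap.dist_apply_le_dist (f := f) (g := ⟨g, hg⟩) x)
  rw [dist_comm] at hfg
  exact h.trans hfg.le

/-- In a regular resistance form, disjoint closed subsets of a compact space are separated by
a function of the domain. -/
theorem Regular.exists_eq_one_eq_zero {Φ : ResistanceForm F} [MetricSpace F] [CompactSpace F]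
    (hreg : Φ.Regular) {K L : Set F} (hK : IsClosed K) (hL : IsClosed L) (hKL : Disjoint K L) :
    ∃ f ∈ Φ.dom, (∀ x ∈ K, f x = 1) ∧ ∀ x ∈ L, f x = 0 := by
  obtain ⟨g, hgL, hgK, -⟩ := exists_continuous_zero_one_of_isClosed hL hK hKL.symm
  obtain ⟨f, hf, -, -, hfg⟩ := hreg g g.continuous (HasCompactSupport.of_compactSpace _)
    (1 / 3) (by norm_num)
  refine ⟨_, (Φ.rf5 _ (Φ.add_mem _ (Φ.smul_mem 3 f hf) _ (Φ.const_mem (-1)))).1,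
    fun x hx => ?_, fun x hx => ?_⟩
  · have h := abs_le.1 (hfg x)
    have hg1 : g x = 1 := hgK hx
    simp only [Pi.add_apply, Pi.smul_apply, smul_eq_mul]
    rw [min_eq_right (by linarith), max_eq_left zero_le_one]
  · have h := abs_le.1 (hfg x)
    have hg0 : g x = 0 := hgL hx
    simp only [Pi.add_apply, Pi.smul_apply, smul_eq_mul]
    exact max_eq_right ((min_le_left _ _).trans (by linarith))

/-- The form induced on a quotient whose points are separated by the compatible functions of
the domain. -/
def quotient (s : Setoid F)
    (hsep : ∀ x y : F, ¬ s x y → ∃ f ∈ Φ.dom, (∀ a b, s a b → f a = f b) ∧ f x ≠ f y) :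
    ResistanceForm (Quotient s) where
  dom := {f | f ∘ Quotient.mk s ∈ Φ.dom}
  energy f g := Φ.energy (f ∘ Quotient.mk s) (g ∘ Quotient.mk s)
  const_mem := Φ.const_mem
  add_mem f hf g hg := Φ.add_mem _ hf _ hg
  smul_mem c f hf := Φ.smul_mem c _ hf
  symm f g := Φ.symm _ _
  add_left f g h := Φ.add_left _ _ _
  smul_left c f g := Φ.smul_left c _ _
  nonneg f hf := Φ.nonneg _ hf
  rf1 f hf := (Φ.rf1 _ hf).trans <|
    exists_congr fun c =>
      ((Quotient.mk_surjective (s := s)).forall (p := fun q => f q = c)).symm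
  rf2 f hf hcauchy := by
    obtain ⟨g, hg, hlim⟩ := Φ.rf2 (fun n => f n ∘ Quotient.mk s) hf hcauchy
    have hcompat : ∀ a b, s a b → g a = g b := by
      intro a b hab
      have hle : ∀ n, (g a - g b) ^ 2 ≤ Φ.Rmet a b *
          Φ.energy (f n ∘ Quotient.mk s - g) (f n ∘ Quotient.mk s - g) := by
        intro n
        have h := Φ.sq_sub_le (Φ.sub_mem (hf n) hg) a b
        have hq : Quotient.mk s a = Quotient.mk s b := Quotient.sound hab
        simp only [Pi.sub_apply, Function.comp_apply, hq] at h
        refine le_trans (le_of_eq ?_) h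
        ring
      have h0 := ge_of_tendsto' (hlim.const_mul (Φ.Rmet a b)) hle
      rw [mul_zero] at h0
      exact sub_eq_zero.1 (pow_eq_zero_iff two_ne_zero |>.1 (le_antisymm h0 (sq_nonneg _)))
    exact ⟨Quotient.lift g hcompat, hg, hlim⟩
  rf3 := by
    intro x y
    induction x using Quotient.inductionOn with | _ x
    induction y using Quotient.inductionOn with | _ y
    intro hxy
    obtain ⟨f, hf, hcompat, hne⟩ := hsep x y fun h => hxy (Quotient.sound h)
    exact ⟨Quotient.lift f hcompat, hf, hne⟩
  rf4 := by
    intro x y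
    induction x using Quotient.inductionOn with | _ x
    induction y using Quotient.inductionOn with | _ y
    refine (Φ.rf4 x y).mono ?_
    rintro _ ⟨f, hf, hpos, rfl⟩
    exact ⟨_, hf, hpos, rfl⟩
  rf5 f hf := Φ.rf5 _ hf

theorem exists_mem_dom_compatible_ne {Φ : ResistanceForm F} [MetricSpace F] [CompactSpace F]
    (hreg : Φ.Regular) {J : ℕ} {V : Fin J → Set F} (hVcl : ∀ j, IsClosed (V j))
    (hVdisj : ∀ i j, i ≠ j → Disjoint (V i) (V j)) (x y : F) (hxy : ¬ fuseSetoid V x y) :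
    ∃ f ∈ Φ.dom, (∀ a b, fuseSetoid V a b → f a = f b) ∧ f x ≠ f y := by
  let K : Set F := {x} ∪ ⋃ j ∈ {j | x ∈ V j}, V j
  let L : Set F := {y} ∪ ⋃ j ∈ {j | x ∉ V j}, V j
  have hK : IsClosed K :=
    isClosed_singleton.union ((Set.toFinite _).isClosed_biUnion fun j _ => hVcl j)
  have hL : IsClosed L :=
    isClosed_singleton.union ((Set.toFinite _).isClosed_biUnion fun j _ => hVcl j)
  have hKL : Disjoint K L := by
    rw [Set.disjoint_left]
    intro z hzK hzL
    simp only [K, L, Set.mem_union, Set.mem_singleton_iff, Set.mem_iUnion, Set.mem_ofPred_eq,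
      exists_prop] at hzK hzL
    rcases hzK with rfl | ⟨j, hxj, hzj⟩
    · rcases hzL with rfl | ⟨i, hxi, hzi⟩
      · exact hxy ((fuseSetoid V).refl _)
      · exact hxi hzi
    · rcases hzL with rfl | ⟨i, hxi, hzi⟩
      · exact hxy (Relation.EqvGen.rel _ _ ⟨j, hxj, hzj⟩)
      · have hij : j ≠ i := by
          rintro rfl
          exact hxi hxj
        exact Set.disjoint_left.1 (hVdisj j i hij) hzj hzi
  obtain ⟨f, hf, hfK, hfL⟩ := hreg.exists_eq_one_eq_zero hK hL hKL
  refine ⟨f, hf, fun a b hab => ?_, ?_⟩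
  · have hle : fuseSetoid V ≤ Setoid.ker f := by
      refine Setoid.eqvGen_le ?_
      rintro a b ⟨j, ha, hb⟩
      change f a = f b
      by_cases hxj : x ∈ V j
      · have hsub : V j ⊆ K := fun z hz => Or.inr (Set.mem_biUnion hxj hz)
        rw [hfK a (hsub ha), hfK b (hsub hb)]
      · have hsub : V j ⊆ L := fun z hz => Or.inr (Set.mem_biUnion (x := j) hxj hz)
        rw [hfL a (hsub ha), hfL b (hsub hb)]
    exact hle hab
  · rw [hfK x (Or.inl rfl), hfL y (Or.inl rfl)]
    exact one_ne_zero

end ResistanceForm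

/-- fusing a regular resistance form on a compact space over finitely many
nonempty pairwise disjoint compact sets `V_1, …, V_J` yields a regular resistance form
`(ℰ̃,𝓕̃)` on the quotient `F̃`, whose resistance metric `R̃` satisfies
`R̃(π(x),π(y)) ≤ R(x,y)` and makes `F̃` a compact metric space. -/
theorem fused_form_is_regular_resistance_form
    {F : Type*} [Nonempty F] [MetricSpace F] [CompactSpace F]
    (Φ : ResistanceForm F) (hdist : ∀ x y : F, dist x y = Φ.Rmet x y)
    (hreg : Φ.Regular) (J : ℕ) (V : Fin J → Set F)
    (hVne : ∀ j, (V j).Nonempty) (hVcomp : ∀ j, IsCompact (V j))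
    (hVdisj : ∀ i j, i ≠ j → Disjoint (V i) (V j)) :
    ∃ Ψ : ResistanceForm (Quotient (fuseSetoid V)),
      -- 𝓕̃ = { f : f ∘ π ∈ 𝓕 } and ℰ̃(f,g) = ℰ(f ∘ π, g ∘ π)
      Ψ.dom = {f | f ∘ Quotient.mk (fuseSetoid V) ∈ Φ.dom} ∧
      (∀ f g : Quotient (fuseSetoid V) → ℝ,
        Ψ.energy f g =
          Φ.energy (f ∘ Quotient.mk (fuseSetoid V)) (g ∘ Quotient.mk (fuseSetoid V))) ∧
      -- R̃(π(x),π(y)) ≤ R(x,y)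
      (∀ x y : F,
        Ψ.Rmet (Quotient.mk (fuseSetoid V) x) (Quotient.mk (fuseSetoid V) y) ≤
          Φ.Rmet x y) ∧
      -- (F̃, R̃) is a compact metric space and the fused form is regular
      ∃ m : MetricSpace (Quotient (fuseSetoid V)),
        (∀ a b : Quotient (fuseSetoid V), m.toDist.dist a b = Ψ.Rmet a b) ∧
        (@CompactSpace _ m.toUniformSpace.toTopologicalSpace) ∧
        (@ResistanceForm.Regular _ Ψ m) := by
  let Ψ := Φ.quotient (fuseSetoid V)
    (ResistanceForm.exists_mem_dom_compatible_ne hreg (fun j => (hVcomp j).isClosed) hVdisj)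
  have hR : ∀ x y : F,
      Ψ.Rmet (Quotient.mk (fuseSetoid V) x) (Quotient.mk (fuseSetoid V) y) ≤ Φ.Rmet x y :=
    fun x y => Ψ.Rmet_le_of_forall (Φ.Rmet_nonneg x y) fun f hf =>
      Φ.sq_sub_le (f := f ∘ Quotient.mk (fuseSetoid V)) hf x y
  let m : MetricSpace (Quotient (fuseSetoid V)) := Ψ.resistanceMetricSpace
  have hcont : @Continuous F (Quotient (fuseSetoid V)) _ m.toUniformSpace.toTopologicalSpace
      (Quotient.mk (fuseSetoid V)) := by
    refine @LipschitzWith.continuous F _ _ m.toPseudoEMetricSpace 1 _ ?_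
    refine @LipschitzWith.of_dist_le_mul F _ _ m.toPseudoMetricSpace 1 _ fun x y => ?_
    rw [hdist, NNReal.coe_one, one_mul]
    exact hR x y
  have hcompact : @CompactSpace _ m.toUniformSpace.toTopologicalSpace :=
    @Function.Surjective.compactSpace F _ _ m.toUniformSpace.toTopologicalSpace _
      hcont _ Quotient.mk_surjective
  exact ⟨Ψ, rfl, fun _ _ => rfl, hR, m, fun _ _ => rfl, hcompact,
    @ResistanceForm.regular_of_compactSpace _ Ψ m hcompact fun _ _ => rfl⟩
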